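/- If there is a supermajority acknowledgment of a checkpoint C and a supermajority link D₁ → D₂ with D₁.t < C.t < D₂.t, then the set of E3-slashable validators contains at least n/3 validators (i.e., 3·|{v : v is E3-slashable}| ≥ n). -/

import Mathlib

/-- A checkpoint is a pair of a block and a slot. -/
structure Checkpoint (Block : Type*) where
  B : Block
  t : ℕ

/-- An FFG vote is a triple of a validator, a source checkpoint and a target checkpoint. -/
abbrev FFGVote (V Block : Type*) := V × Checkpoint Block × Checkpoint Block

/-- Every FFG vote in the vote set satisfies `source.t < target.t` and `source.B ≼ target.B`. -/
def ValidVotes {V Block : Type*} [PartialOrder Block] (Votes : Set (FFGVote V Block)) : Prop :=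
  ∀ p ∈ Votes, p.2.1.t < p.2.2.t ∧ p.2.1.B ≤ p.2.2.B

/-- There is a supermajority link `C₁ → C₂`: at least `2n/3` validators cast the FFG vote
`(v, C₁, C₂)`. -/
def SMLink {V Block : Type*} (n : ℕ) (Votes : Set (FFGVote V Block))
    (C₁ C₂ : Checkpoint Block) : Prop :=
  ∃ S : Finset V, 2 * n ≤ 3 * S.card ∧ ∀ v ∈ S, (v, C₁, C₂) ∈ Votes

/-- A checkpoint `C` is justified if there is a chain of `k ≥ 0` supermajority links from the
genesis checkpoint `Cgen` to `C`. -/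
def Justified {V Block : Type*} (n : ℕ) (Votes : Set (FFGVote V Block))
    (Cgen C : Checkpoint Block) : Prop :=
  Relation.ReflTransGen (SMLink n Votes) Cgen C

/-- A checkpoint `C` is finalized if it is justified and there is a supermajority link `C → C'`
with `C'.t = C.t + 1`. -/
def Finalized {V Block : Type*} (n : ℕ) (Votes : Set (FFGVote V Block))
    (Cgen C : Checkpoint Block) : Prop :=
  Justified n Votes Cgen C ∧ ∃ C' : Checkpoint Block, SMLink n Votes C C' ∧ C'.t = C.t + 1

/-- `v` is E1-slashable (equivocation): `Votes` contains two distinct votes by `v` whose targets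
have the same slot. -/
def E1Slashable {V Block : Type*} (Votes : Set (FFGVote V Block)) (v : V) : Prop :=
  ∃ p q : FFGVote V Block, p ∈ Votes ∧ q ∈ Votes ∧ p.1 = v ∧ q.1 = v ∧ p ≠ q ∧ p.2.2.t = q.2.2.t

/-- `v` is E2-slashable (surround voting): `Votes` contains votes `(v, C₁, C₂)` and `(v, C₃, C₄)`
with `C₃.t < C₁.t < C₂.t < C₄.t`. -/
def E2Slashable {V Block : Type*} (Votes : Set (FFGVote V Block)) (v : V) : Prop :=
  ∃ C₁ C₂ C₃ C₄ : Checkpoint Block, (v, C₁, C₂) ∈ Votes ∧ (v, C₃, C₄) ∈ Votes ∧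
    C₃.t < C₁.t ∧ C₁.t < C₂.t ∧ C₂.t < C₄.t

/-- There is a supermajority acknowledgment of `C`: at least `2n/3` validators `v` have
`(v, C) ∈ Acks`. -/
def SMAck {V Block : Type*} (n : ℕ) (Acks : Set (V × Checkpoint Block))
    (C : Checkpoint Block) : Prop :=
  ∃ S : Finset V, 2 * n ≤ 3 * S.card ∧ ∀ v ∈ S, (v, C) ∈ Acks

/-- `v` is E3-slashable: `Votes` contains a vote `(v, C₁, C₂)` and `Acks` contains `(v, C)` with
`C₁.t < C.t < C₂.t`. -/
def E3Slashable {V Block : Type*} (Votes : Set (FFGVote V Block))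
    (Acks : Set (V × Checkpoint Block)) (v : V) : Prop :=
  ∃ C₁ C₂ C : Checkpoint Block, (v, C₁, C₂) ∈ Votes ∧ (v, C) ∈ Acks ∧ C₁.t < C.t ∧ C.t < C₂.t

/-- A checkpoint is ack-finalized if it is justified and either is finalized or has a
supermajority acknowledgment. -/
def AckFinalized {V Block : Type*} (n : ℕ) (Votes : Set (FFGVote V Block))
    (Acks : Set (V × Checkpoint Block)) (Cgen C : Checkpoint Block) : Prop :=
  Justified n Votes Cgen C ∧ (Finalized n Votes Cgen C ∨ SMAck n Acks C)

/-- Two sets of validators, each of size at least `2n/3`, share at least `n/3` validators. -/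
theorem card_le_three_mul_card_inter {V : Type*} [Fintype V] [DecidableEq V] {S T : Finset V}
    (hS : 2 * Fintype.card V ≤ 3 * S.card) (hT : 2 * Fintype.card V ≤ 3 * T.card) :
    Fintype.card V ≤ 3 * (S ∩ T).card := by
  have hunion := Finset.card_le_univ (S ∪ T)
  have hsum := Finset.card_union_add_card_inter S T
  omega

/-- If there is a supermajority acknowledgment of `C` and a supermajority link `D₁ → D₂` with
`D₁.t < C.t < D₂.t`, then at least `n/3` validators are E3-slashable. -/
theorem ack_surround_slashing
    {V Block : Type*} [Fintype V] [PartialOrder Block]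
    (n : ℕ) (hn : Fintype.card V = n)
    (Votes : Set (FFGVote V Block)) (hvalid : ValidVotes Votes)
    (Acks : Set (V × Checkpoint Block))
    (C D₁ D₂ : Checkpoint Block)
    (hack : SMAck n Acks C) (hlink : SMLink n Votes D₁ D₂)
    (h1 : D₁.t < C.t) (h2 : C.t < D₂.t) :
    n ≤ 3 * {v : V | E3Slashable Votes Acks v}.ncard := by
  classical
  subst hn
  obtain ⟨S, hS, hSack⟩ := hack
  obtain ⟨T, hT, hTvote⟩ := hlink
  have hsub : ((S ∩ T : Finset V) : Set V) ⊆ {v : V | E3Slashable Votes Acks v} := by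
    intro v hv
    obtain ⟨hvS, hvT⟩ := Finset.mem_inter.mp (Finset.mem_coe.mp hv)
    exact ⟨D₁, D₂, C, hTvote v hvT, hSack v hvS, h1, h2⟩
  have hcard := Set.ncard_le_ncard hsub (Set.toFinite _)
  rw [Set.ncard_coe_finset] at hcard
  exact (card_le_three_mul_card_inter hS hT).trans (Nat.mul_le_mul_left 3 hcard)
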